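/- Let 0 < ρ < 1/2 and fix x_3 ∈ ℝ. Let g_{x_3} be the Gaussian density on ℝ² with mean ((1 − ρ)x_3, (1 − ρ)x_3) and covariance matrix with rows (ρ(2 − ρ), −ρ²), (−ρ², ρ(2 − ρ)), and let g be the Gaussian density on ℝ² with mean 0 and covariance with rows (1, 1 − 2ρ), (1 − 2ρ, 1). Then the Kullback–Leibler divergence satisfies ∫_{ℝ²} g_{x_3}(x) log( g_{x_3}(x)/g(x) ) dx = (1/2)[ 1 + ρ + (1 − ρ)x_3² − log ρ ] − 1. -/

import Mathlib

open MeasureTheory Matrix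

/-- The Gaussian density on `ℝ^n` with mean `m` and covariance matrix `C`:
`N(m,C)(x) = (2π)^{-n/2} (det C)^{-1/2} exp(-(1/2)(x−m)ᵀ C⁻¹ (x−m))`. -/
noncomputable def gaussianDensity {n : ℕ} (m : Fin n → ℝ) (C : Matrix (Fin n) (Fin n) ℝ)
    (x : Fin n → ℝ) : ℝ :=
  (Real.sqrt ((2 * Real.pi) ^ n * C.det))⁻¹ *
    Real.exp (-(1 / 2) * ((x - m) ⬝ᵥ (C⁻¹ *ᵥ (x - m))))

open ProbabilityTheory

/-- Linear change of variables for integrals over `ι → ℝ`. -/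
theorem integral_comp_toLin'_of_det_ne_zero {ι : Type*} [Fintype ι] [DecidableEq ι]
    {M : Matrix ι ι ℝ} (hM : M.det ≠ 0) (f : (ι → ℝ) → ℝ) :
    ∫ x, f (M.toLin' x) = |M.det|⁻¹ * ∫ x, f x := by
  have hdet : LinearMap.det M.toLin' ≠ 0 := by simpa using hM
  have hemb : MeasurableEmbedding M.toLin' :=
    (LinearEquiv.toContinuousLinearEquiv
      (LinearMap.equivOfDetNeZero M.toLin' hdet)).toHomeomorph.measurableEmbedding
  rw [← hemb.integral_map f, Real.map_matrix_volume_pi_eq_smul_volume_pi hM,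
    integral_smul_measure, ENNReal.toReal_ofReal (abs_nonneg _), abs_inv, smul_eq_mul]

/-- Integration in the sum and difference coordinates on `ℝ²`. -/
theorem integral_mul_sum_diff (f g : ℝ → ℝ) :
    ∫ x : Fin 2 → ℝ, f (x 0 + x 1) * g (x 0 - x 1) = (1 / 2) * ((∫ s, f s) * ∫ d, g d) := by
  have hdet : (!![1, 1; 1, -1] : Matrix (Fin 2) (Fin 2) ℝ).det = -2 := by
    rw [det_fin_two_of]; norm_num
  have h := integral_comp_toLin'_of_det_ne_zero (by rw [hdet]; norm_num)
    (fun y : Fin 2 → ℝ => ∏ i, (![f, g] i) (y i))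
  rw [integral_fintype_prod_volume_eq_prod ![f, g], hdet] at h
  simpa [Matrix.mulVec, dotProduct, Fin.sum_univ_two, Fin.prod_univ_two, sub_eq_add_neg] using h

/-- A bivariate Gaussian density with equal variances factors in the sum and difference
coordinates. -/
theorem gaussianDensity_fin_two_eq_mul (m x : Fin 2 → ℝ) {a b : ℝ}
    (hs : 0 < a + b) (hd : 0 < a - b) :
    gaussianDensity m !![a, b; b, a] x =
      2 * (gaussianPDFReal (m 0 + m 1) (2 * (a + b)).toNNReal (x 0 + x 1) *
        gaussianPDFReal (m 0 - m 1) (2 * (a - b)).toNNReal (x 0 - x 1)) := by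
  have hdet : (!![a, b; b, a] : Matrix (Fin 2) (Fin 2) ℝ).det = (a + b) * (a - b) := by
    rw [det_fin_two_of]; ring
  have hsqrt : √(2 * Real.pi * (2 * (a + b))) * √(2 * Real.pi * (2 * (a - b))) =
      2 * √((2 * Real.pi) ^ 2 * ((a + b) * (a - b))) := by
    rw [← Real.sqrt_mul (by positivity), show (2 : ℝ) = √(2 ^ 2) by simp,
      ← Real.sqrt_mul (by positivity)]
    congr 1
    simp only [Nat.ofNat_nonneg, Real.sqrt_sq]
    ring
  have hquad : -(1 / 2) * ((x - m) ⬝ᵥ ((!![a, b; b, a])⁻¹ *ᵥ (x - m))) =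
      -(x 0 + x 1 - (m 0 + m 1)) ^ 2 / (2 * (2 * (a + b))) +
        -(x 0 - x 1 - (m 0 - m 1)) ^ 2 / (2 * (2 * (a - b))) := by
    rw [Matrix.inv_def, hdet, Ring.inverse_eq_inv', adjugate_fin_two_of]
    simp only [dotProduct, Matrix.mulVec, Fin.sum_univ_two, Matrix.smul_apply, Pi.sub_apply,
      Matrix.of_apply, Matrix.cons_val_zero, Matrix.cons_val_one, smul_eq_mul,
      Matrix.cons_val', Matrix.cons_val_fin_one]
    field_simp
    ring
  rw [gaussianDensity, hdet, hquad, Real.exp_add, gaussianPDFReal, gaussianPDFReal,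
    Real.coe_toNNReal _ (by positivity), Real.coe_toNNReal _ (by positivity),
    mul_mul_mul_comm, ← mul_inv, hsqrt, mul_inv]
  ring

theorem log_gaussianPDFReal (μ : ℝ) {v : NNReal} (hv : v ≠ 0) (x : ℝ) :
    Real.log (gaussianPDFReal μ v x) =
      -(1 / 2) * Real.log (2 * Real.pi) - (1 / 2) * Real.log v - (x - μ) ^ 2 / (2 * v) := by
  have hv' : (0 : ℝ) < v := by positivity
  rw [gaussianPDFReal, Real.log_mul (by positivity) (Real.exp_ne_zero _), Real.log_exp,
    Real.log_inv, Real.log_sqrt (by positivity), Real.log_mul (by positivity) hv'.ne']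
  ring

/-- The Kullback–Leibler divergence between two univariate Gaussians. -/
theorem integral_gaussianPDFReal_mul_log_div (μ₁ μ₂ : ℝ) {v₁ v₂ : NNReal}
    (h₁ : v₁ ≠ 0) (h₂ : v₂ ≠ 0) :
    ∫ x, gaussianPDFReal μ₁ v₁ x *
        Real.log (gaussianPDFReal μ₁ v₁ x / gaussianPDFReal μ₂ v₂ x) =
      (1 / 2) * (v₁ / v₂ + (μ₁ - μ₂) ^ 2 / v₂ - 1 - Real.log (v₁ / v₂)) := by
  have h₁' : (v₁ : ℝ) ≠ 0 := by exact_mod_cast h₁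
  have h₂' : (v₂ : ℝ) ≠ 0 := by exact_mod_cast h₂
  have hmem : MemLp (fun x : ℝ => x) 2 (gaussianReal μ₁ v₁) := memLp_id_gaussianReal 2
  have hvar : ∫ x, x ^ 2 ∂gaussianReal μ₁ v₁ = v₁ + μ₁ ^ 2 := by
    have h := variance_eq_sub hmem
    rw [variance_fun_id_gaussianReal, integral_id_gaussianReal] at h
    simp only [Pi.pow_apply] at h
    linarith
  have hid_int : Integrable (fun x : ℝ => x) (gaussianReal μ₁ v₁) := hmem.integrable (by norm_num)
  have hsq_int : Integrable (fun x : ℝ => x ^ 2) (gaussianReal μ₁ v₁) := hmem.integrable_sq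
  have hlog (x : ℝ) : Real.log (gaussianPDFReal μ₁ v₁ x / gaussianPDFReal μ₂ v₂ x) =
      (1 / (2 * v₂) - 1 / (2 * v₁)) * x ^ 2 + (μ₁ / v₁ - μ₂ / v₂) * x +
        (μ₂ ^ 2 / (2 * v₂) - μ₁ ^ 2 / (2 * v₁) - (1 / 2) * Real.log (v₁ / v₂)) := by
    rw [Real.log_div (gaussianPDFReal_pos _ _ _ h₁).ne' (gaussianPDFReal_pos _ _ _ h₂).ne',
      log_gaussianPDFReal _ h₁, log_gaussianPDFReal _ h₂, Real.log_div h₁' h₂']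
    field_simp
    ring
  simp_rw [← smul_eq_mul (gaussianPDFReal μ₁ v₁ _)]
  rw [← integral_gaussianReal_eq_integral_smul h₁]
  simp_rw [hlog]
  have hadd : Integrable (fun x : ℝ => (1 / (2 * (v₂ : ℝ)) - 1 / (2 * v₁)) * x ^ 2 +
      (μ₁ / v₁ - μ₂ / v₂) * x) (gaussianReal μ₁ v₁) :=
    (hsq_int.const_mul _).add (hid_int.const_mul _)
  rw [integral_add hadd (integrable_const _),
    integral_add (hsq_int.const_mul _) (hid_int.const_mul _), integral_const_mul,
    integral_const_mul, hvar, integral_id_gaussianReal]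
  simp only [integral_const, probReal_univ, smul_eq_mul]
  field_simp
  ring

/-- The Kullback–Leibler divergence between the bivariate Gaussian with mean
`((1−ρ)x₃, (1−ρ)x₃)` and covariance rows `(ρ(2−ρ), −ρ²), (−ρ², ρ(2−ρ))` and the
centered bivariate Gaussian with covariance rows `(1, 1−2ρ), (1−2ρ, 1)` equals
`½[1 + ρ + (1−ρ)x₃² − log ρ] − 1`. -/
theorem kl_divergence_gaussian_example_two (ρ x₃ : ℝ) (hρ0 : 0 < ρ) (hρ : ρ < 1 / 2) :
    (∫ x : Fin 2 → ℝ,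
        gaussianDensity ![(1 - ρ) * x₃, (1 - ρ) * x₃]
            !![ρ * (2 - ρ), -ρ ^ 2; -ρ ^ 2, ρ * (2 - ρ)] x *
          Real.log (gaussianDensity ![(1 - ρ) * x₃, (1 - ρ) * x₃]
              !![ρ * (2 - ρ), -ρ ^ 2; -ρ ^ 2, ρ * (2 - ρ)] x /
            gaussianDensity (0 : Fin 2 → ℝ) !![1, 1 - 2 * ρ; 1 - 2 * ρ, 1] x))
      = (1 / 2) * (1 + ρ + (1 - ρ) * x₃ ^ 2 - Real.log ρ) - 1 := by
  have hs₁ : 0 < ρ * (2 - ρ) + -ρ ^ 2 := by nlinarith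
  have hd₁ : 0 < ρ * (2 - ρ) - -ρ ^ 2 := by nlinarith
  have hs₀ : 0 < 1 + (1 - 2 * ρ) := by linarith
  have hd₀ : 0 < 1 - (1 - 2 * ρ) := by linarith
  have hd : ρ * (2 - ρ) - -ρ ^ 2 = 1 - (1 - 2 * ρ) := by ring
  have hvs₁ : (2 * (ρ * (2 - ρ) + -ρ ^ 2)).toNNReal ≠ 0 := by
    simpa only [ne_eq, Real.toNNReal_eq_zero, not_le] using mul_pos two_pos hs₁
  have hvs₀ : (2 * (1 + (1 - 2 * ρ))).toNNReal ≠ 0 := by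
    simpa only [ne_eq, Real.toNNReal_eq_zero, not_le] using mul_pos two_pos hs₀
  have hvd : (2 * (1 - (1 - 2 * ρ))).toNNReal ≠ 0 := by
    simpa only [ne_eq, Real.toNNReal_eq_zero, not_le] using mul_pos two_pos hd₀
  simp_rw [gaussianDensity_fin_two_eq_mul _ _ hs₁ hd₁, gaussianDensity_fin_two_eq_mul _ _ hs₀ hd₀,
    hd]
  simp only [Matrix.cons_val_zero, Matrix.cons_val_one, Pi.zero_apply, sub_self, add_zero]
  set v₁ := (2 * (ρ * (2 - ρ) + -ρ ^ 2)).toNNReal with hv₁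
  set v₀ := (2 * (1 + (1 - 2 * ρ))).toNNReal with hv₀
  set w := (2 * (1 - (1 - 2 * ρ))).toNNReal
  set μ := (1 - ρ) * x₃ + (1 - ρ) * x₃ with hμ
  have hratio (s d : ℝ) : 2 * (gaussianPDFReal μ v₁ s * gaussianPDFReal 0 w d) /
      (2 * (gaussianPDFReal 0 v₀ s * gaussianPDFReal 0 w d)) =
      gaussianPDFReal μ v₁ s / gaussianPDFReal 0 v₀ s := by
    rw [mul_div_mul_left _ _ two_ne_zero,
      mul_div_mul_right _ _ (gaussianPDFReal_pos _ _ _ hvd).ne']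
  simp_rw [hratio]
  have hsplit (x : Fin 2 → ℝ) :
      2 * (gaussianPDFReal μ v₁ (x 0 + x 1) * gaussianPDFReal 0 w (x 0 - x 1)) *
        Real.log (gaussianPDFReal μ v₁ (x 0 + x 1) / gaussianPDFReal 0 v₀ (x 0 + x 1)) =
      2 * (gaussianPDFReal μ v₁ (x 0 + x 1) *
        Real.log (gaussianPDFReal μ v₁ (x 0 + x 1) / gaussianPDFReal 0 v₀ (x 0 + x 1)) *
          gaussianPDFReal 0 w (x 0 - x 1)) := by
    ring
  simp_rw [hsplit]
  rw [integral_const_mul, integral_mul_sum_diff (fun s => gaussianPDFReal μ v₁ s *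
      Real.log (gaussianPDFReal μ v₁ s / gaussianPDFReal 0 v₀ s)) (gaussianPDFReal 0 w),
    integral_gaussianPDFReal_eq_one 0 hvd,
    integral_gaussianPDFReal_mul_log_div _ _ hvs₁ hvs₀, hv₁, hv₀,
    Real.coe_toNNReal _ (by positivity), Real.coe_toNNReal _ (by positivity)]
  have h1ρ : 1 - ρ ≠ 0 := by linarith
  have hvar : 2 * (ρ * (2 - ρ) + -ρ ^ 2) / (2 * (1 + (1 - 2 * ρ))) = ρ := by
    rw [div_eq_iff (by positivity)]
    ring
  have hmean : (μ - 0) ^ 2 / (2 * (1 + (1 - 2 * ρ))) = (1 - ρ) * x₃ ^ 2 := by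
    rw [hμ, div_eq_iff (by positivity)]
    ring
  rw [hvar, hmean]
  ring
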